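/- Let I be a C*-algebra whose multiplier algebra M(I) is extremally rich, and suppose a unital C*-algebra A contains I as a closed two-sided ideal. Then every unitary u in A/I lifts to an extremal partial isometry in A. -/

import Mathlib

open scoped MultiplierAlgebra

/-- A unital C*-algebra `A` is *extremally rich* if the set
`A⁻¹ 𝓔(A) A⁻¹ = {x * u * y : x, y invertible, u an extreme point of the closed unit ball}`
is dense in `A`. -/
def ExtremallyRich (A : Type*) [CStarAlgebra A] : Prop :=
  Dense {a : A | ∃ x u y : A, IsUnit x ∧ IsUnit y ∧
    u ∈ Set.extremePoints ℝ (Metric.closedBall (0 : A) 1) ∧ a = x * u * y}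

section ExtremePoints

variable {A : Type*} [CStarAlgebra A]

lemma CStarAlgebra.norm_le_one_iff_star_mul_self_le_one [PartialOrder A] [StarOrderedRing A]
    {a : A} : ‖a‖ ≤ 1 ↔ star a * a ≤ 1 := by
  rw [← CStarAlgebra.norm_le_one_iff_of_nonneg _ (star_mul_self_nonneg a),
    CStarRing.norm_star_mul_self, ← sq, sq_le_one_iff₀ (norm_nonneg a)]

lemma CStarAlgebra.norm_le_one_iff_mul_star_self_le_one [PartialOrder A] [StarOrderedRing A]
    {a : A} : ‖a‖ ≤ 1 ↔ a * star a ≤ 1 := by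
  rw [← norm_star, CStarAlgebra.norm_le_one_iff_star_mul_self_le_one, star_star]

lemma eq_zero_of_mem_extremePoints_closedBall {v d : A}
    (hv : v ∈ Set.extremePoints ℝ (Metric.closedBall (0 : A) 1))
    (h₁ : ‖v + d‖ ≤ 1) (h₂ : ‖v - d‖ ≤ 1) : d = 0 := by
  have h := hv.2 (mem_closedBall_zero_iff.2 h₁) (mem_closedBall_zero_iff.2 h₂)
    ⟨1 / 2, 1 / 2, by norm_num, by norm_num, by norm_num, by module⟩
  simpa using h

/-- An extreme point of the closed unit ball is a partial isometry. -/
lemma mul_star_mul_self_of_mem_extremePoints_closedBall {v : A}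
    (hv : v ∈ Set.extremePoints ℝ (Metric.closedBall (0 : A) 1)) : v * star v * v = v := by
  let := CStarAlgebra.spectralOrder A
  have := CStarAlgebra.spectralOrderedRing A
  have hv1 : ‖v‖ ≤ 1 := mem_closedBall_zero_iff.1 hv.1
  have hk0 : 0 ≤ star v * v := star_mul_self_nonneg v
  have hk1 : star v * v ≤ 1 := CStarAlgebra.norm_le_one_iff_star_mul_self_le_one.1 hv1
  have hksa : IsSelfAdjoint (star v * v) := .star_mul_self v
  set k := star v * v with hk
  have hfour : (4 : A) = 1 + 1 + 1 + 1 := by norm_num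
  have hfour' : (4 : A) = (4 : ℝ) • 1 := by
    rw [← Algebra.algebraMap_eq_smul_one, map_ofNat]
  have hthree : (3 : A) = 1 + 1 + 1 := by norm_num
  have hthree' : (3 : A) = (3 : ℝ) • 1 := by
    rw [← Algebra.algebraMap_eq_smul_one, map_ofNat]
  have hd : (1 / 2 : ℝ) • (v * (1 - k)) = 0 := by
    refine eq_zero_of_mem_extremePoints_closedBall hv ?_ ?_
    · rw [CStarAlgebra.norm_le_one_iff_star_mul_self_le_one, ← sub_nonneg]
      have h4 : (0 : A) ≤ 4 - k := by
        have : (4 : A) - k = (1 - k) + (1 + 1 + 1) := by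
          rw [hfour]; abel
        rw [this]
        have := sub_nonneg.2 hk1
        have h1 : (0 : A) ≤ 1 := zero_le_one
        positivity
      have h5 := star_left_conjugate_nonneg h4 (1 - k)
      have h6 : 1 - star (v + (1 / 2 : ℝ) • (v * (1 - k))) * (v + (1 / 2 : ℝ) • (v * (1 - k)))
          = (1 / 4 : ℝ) • (star (1 - k) * (4 - k) * (1 - k)) := by
        have e1 : v + (1 / 2 : ℝ) • (v * (1 - k)) = v * ((1 / 2 : ℝ) • (3 - k)) := by
          rw [hthree']
          simp only [mul_sub, smul_sub, mul_smul_comm, mul_one]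
          module
        have e2 : star (v * ((1 / 2 : ℝ) • (3 - k))) * (v * ((1 / 2 : ℝ) • (3 - k)))
            = (1 / 4 : ℝ) • ((3 - k) * k * (3 - k)) := by
          rw [star_mul, star_smul, star_sub, hksa.star_eq, hk]
          simp only [smul_mul_assoc, mul_smul_comm, smul_smul, star_ofNat, star_trivial, mul_assoc]
          norm_num
        have e3 : (1 : A) = (1 / 4 : ℝ) • 4 := by
          rw [hfour', smul_smul]; norm_num
        rw [e1, e2, star_sub, hksa.star_eq, star_one]
        nth_rewrite 1 [e3]
        rw [← smul_sub]
        congr 1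
        rw [hfour, hthree]
        noncomm_ring
      rw [h6]
      exact smul_nonneg (by norm_num) h5
    · have e : v - (1 / 2 : ℝ) • (v * (1 - k)) = (1 / 2 : ℝ) • (v * (1 + k)) := by
        simp only [mul_sub, mul_add, smul_sub, smul_add, mul_one]
        module
      have hkn : ‖k‖ ≤ 1 := (CStarAlgebra.norm_le_one_iff_of_nonneg _ hk0).2 hk1
      have h1n : ‖(1 : A)‖ ≤ 1 := (CStarAlgebra.norm_le_one_iff_of_nonneg _ zero_le_one).2 le_rfl
      rw [e, norm_smul]
      have h2 : ‖1 + k‖ ≤ 2 := (norm_add_le _ _).trans (by linarith)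
      have h3 : ‖v * (1 + k)‖ ≤ 1 * 2 :=
        (norm_mul_le _ _).trans (mul_le_mul hv1 h2 (norm_nonneg _) zero_le_one)
      norm_num
      linarith
  have h0 : v * (1 - k) = 0 := by simpa using hd
  rw [mul_sub, mul_one, sub_eq_zero, hk, ← mul_assoc] at h0
  exact h0.symm

lemma one_sub_mul_mul_one_sub_of_mem_extremePoints_closedBall {v : A}
    (hv : v ∈ Set.extremePoints ℝ (Metric.closedBall (0 : A) 1)) (z : A) :
    (1 - v * star v) * z * (1 - star v * v) = 0 := by
  let := CStarAlgebra.spectralOrder A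
  have := CStarAlgebra.spectralOrderedRing A
  have hpi := mul_star_mul_self_of_mem_extremePoints_closedBall hv
  have hpi' : star v * v * star v = star v := by
    simpa [mul_assoc] using congrArg star hpi
  have hp : IsStarProjection (star v * v) :=
    ⟨by rw [IsIdempotentElem, ← mul_assoc, hpi'], .star_mul_self v⟩
  have key : ∀ d : A, star v * d = 0 → d * (star v * v) = 0 → ‖d‖ ≤ 1 → d = 0 := by
    intro d hd1 hd2 hdn
    have hd1' : star d * v = 0 := by simpa using congrArg star hd1
    have hdd : star d * d ≤ 1 - star v * v := by
      have h := star_left_conjugate_le_conjugate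
        (CStarAlgebra.norm_le_one_iff_star_mul_self_le_one.1 hdn) (1 - star v * v)
      have e1 : star (1 - star v * v) * (star d * d) * (1 - star v * v) = star d * d := by
        have : d * (1 - star v * v) = d := by rw [mul_sub, hd2]; simp
        calc _ = star (d * (1 - star v * v)) * (d * (1 - star v * v)) := by
              rw [star_mul]; simp only [mul_assoc]
          _ = _ := by rw [this]
      rw [e1, mul_one, hp.one_sub.isSelfAdjoint.star_eq,
        hp.one_sub.isIdempotentElem.eq] at h
      exact h
    have hdd' : star v * v + star d * d ≤ 1 := by
      rw [le_sub_iff_add_le'] at hdd; exact hdd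
    refine eq_zero_of_mem_extremePoints_closedBall hv ?_ ?_ <;>
    rw [CStarAlgebra.norm_le_one_iff_star_mul_self_le_one] <;> refine le_of_eq_of_le ?_ hdd' <;>
    simp [mul_add, add_mul, mul_sub, sub_mul, hd1, hd1']
  by_contra hne
  set d := (1 - v * star v) * z * (1 - star v * v) with hd
  have hd1 : star v * d = 0 := by
    rw [hd, ← mul_assoc, ← mul_assoc, mul_sub (star v), ← mul_assoc, hpi']; simp
  have hd2 : d * (star v * v) = 0 := by
    rw [hd, mul_assoc, hp.isIdempotentElem.one_sub_mul_self, mul_zero]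
  have hn : ‖d‖ ≠ 0 := norm_ne_zero_iff.2 hne
  have := key (‖d‖⁻¹ • d) (by rw [mul_smul_comm, hd1, smul_zero])
    (by rw [smul_mul_assoc, hd2, smul_zero]) (by rw [norm_smul]; simp [hn])
  simp [hn] at this
  exact hne this

/-- A partial isometry `v` with `(1 - v v*) A (1 - v* v) = 0` is an extreme point of the closed
unit ball. -/
lemma mem_extremePoints_closedBall_of_one_sub_mul_mul_one_sub {v : A}
    (hpi : v * star v * v = v) (hv : ∀ z, (1 - v * star v) * z * (1 - star v * v) = 0) :
    v ∈ Set.extremePoints ℝ (Metric.closedBall (0 : A) 1) := by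
  let := CStarAlgebra.spectralOrder A
  have := CStarAlgebra.spectralOrderedRing A
  have hpi' : star v * v * star v = star v := by
    simpa [mul_assoc] using congrArg star hpi
  have hp : IsStarProjection (star v * v) :=
    ⟨by rw [IsIdempotentElem, ← mul_assoc, hpi'], .star_mul_self v⟩
  have hq : IsStarProjection (v * star v) :=
    ⟨by rw [IsIdempotentElem, ← mul_assoc, hpi], .mul_star_self v⟩
  have key : ∀ {p c : A} {r : ℝ}, IsStarProjection p → 0 < r →
      r • (star c * c) ≤ 1 - p → c * p = 0 := by
    intro p c r hp hr h
    have h1 := star_left_conjugate_le_conjugate h p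
    have e : star p * (1 - p) * p = 0 := by
      rw [mul_assoc, hp.isIdempotentElem.one_sub_mul_self, mul_zero]
    have e' : star p * (r • (star c * c)) * p = r • (star (c * p) * (c * p)) := by
      rw [star_mul]; simp only [mul_smul_comm, smul_mul_assoc, mul_assoc]
    rw [e, e'] at h1
    have h2 : r • (star (c * p) * (c * p)) = 0 :=
      le_antisymm h1 (smul_nonneg hr.le (star_mul_self_nonneg _))
    rw [smul_eq_zero, or_iff_right hr.ne'] at h2
    exact CStarRing.star_mul_self_eq_zero_iff _ |>.1 h2
  refine ⟨mem_closedBall_zero_iff.2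
    (CStarAlgebra.norm_le_one_iff_star_mul_self_le_one.2 hp.le_one), ?_⟩
  rintro a ha b hb ⟨t, s, ht, hs, hts, hab⟩
  rw [mem_closedBall_zero_iff] at ha hb
  have hst : s = 1 - t := by linarith
  have h1 : (t * s) • (star (a - b) * (a - b)) ≤ 1 - star v * v := by
    have ha' := smul_le_smul_of_nonneg_left
      (CStarAlgebra.norm_le_one_iff_star_mul_self_le_one.1 ha) ht.le
    have hb' := smul_le_smul_of_nonneg_left
      (CStarAlgebra.norm_le_one_iff_star_mul_self_le_one.1 hb) hs.le
    have h := add_le_add ha' hb'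
    rw [← add_smul, hts, one_smul] at h
    rw [le_sub_iff_add_le]
    refine le_of_eq_of_le ?_ h
    rw [← hab, hst]
    simp only [star_add, star_sub, star_smul, star_trivial, add_mul, mul_add, sub_mul, mul_sub,
      smul_mul_assoc, mul_smul_comm]
    module
  have h2 : (t * s) • (star (star (a - b)) * star (a - b)) ≤ 1 - v * star v := by
    have ha' := smul_le_smul_of_nonneg_left
      (CStarAlgebra.norm_le_one_iff_mul_star_self_le_one.1 ha) ht.le
    have hb' := smul_le_smul_of_nonneg_left
      (CStarAlgebra.norm_le_one_iff_mul_star_self_le_one.1 hb) hs.le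
    have h := add_le_add ha' hb'
    rw [← add_smul, hts, one_smul] at h
    rw [le_sub_iff_add_le]
    refine le_of_eq_of_le ?_ h
    rw [← hab, hst]
    simp only [star_add, star_sub, star_star, star_smul, star_trivial, add_mul, mul_add, sub_mul,
      mul_sub, smul_mul_assoc, mul_smul_comm]
    module
  have k1 := key hp (mul_pos ht hs) h1
  have k2 : v * star v * (a - b) = 0 := by
    simpa [mul_assoc] using congrArg star (key hq (mul_pos ht hs) h2)
  have k3 := hv (a - b)
  rw [sub_mul, k2, one_mul, sub_zero, mul_sub, k1, mul_one, sub_zero, sub_eq_zero] at k3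
  rw [← hab, ← k3, ← add_smul, hts, one_smul]

end ExtremePoints

section PolarDecomposition

variable {A : Type*} [CStarAlgebra A]

/-- A von Neumann regular element `b` of a C*-algebra has a polar decomposition `b = v * h`. -/
lemma exists_polarDecomposition_of_mul_mul_eq_self {b c : A} (hbc : b * c * b = b) :
    ∃ v h : A, IsSelfAdjoint h ∧ IsUnit (h + 1) ∧ h * h = star b * b ∧ v * h = b ∧
      v * star v * v = v ∧ b * (1 - star v * v) = 0 ∧ (1 - v * star v) * b = 0 := by
  let := CStarAlgebra.spectralOrder A
  have := CStarAlgebra.spectralOrderedRing A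
  have hk0 : 0 ≤ star b * b := star_mul_self_nonneg b
  have hksa : IsSelfAdjoint (star b * b) := .star_mul_self b
  have hkcb : star b * b * (c * b) = star b * b := by
    rw [mul_assoc, ← mul_assoc b, hbc]
  have hkcb' : star (c * b) * (star b * b) = star b * b := by
    simpa [mul_assoc] using congrArg star hkcb
  set k := star b * b with hk
  have hspec0 : ∀ t ∈ spectrum ℝ k, 0 ≤ t := fun t ht ↦ spectrum_nonneg_of_nonneg hk0 ht
  set D : ℝ := ‖c‖ ^ 2 + 1 with hD
  have hDpos : 0 < D := by positivity
  have hgap : ∀ t ∈ spectrum ℝ k, t = 0 ∨ D⁻¹ ≤ t := by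
    have h1 : star (c * b) * (c * b) ≤ D • k := by
      have hc : star c * c ≤ algebraMap ℝ A D :=
        CStarAlgebra.star_mul_le_algebraMap_norm_sq.trans
          (algebraMap_mono A (by rw [hD]; linarith))
      have := star_left_conjugate_le_conjugate hc b
      rw [← Algebra.commutes, mul_assoc _ (star b) b, ← Algebra.smul_def] at this
      simpa [mul_assoc] using this
    have h2 : 0 ≤ (D ^ 2) • (k * k) - D • k := by
      have h3 := star_mul_self_nonneg (D • k - c * b)
      have h4 : star (D • k - c * b) * (D • k - c * b)
          = (D ^ 2) • (k * k) - (2 * D) • k + star (c * b) * (c * b) := by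
        rw [star_sub, star_smul, hksa.star_eq, star_trivial]
        simp only [sub_mul, mul_sub, smul_mul_assoc, mul_smul_comm, hkcb, hkcb']
        module
      rw [h4] at h3
      calc (0 : A) ≤ _ := h3
        _ ≤ (D ^ 2) • (k * k) - (2 * D) • k + D • k := by gcongr
        _ = _ := by module
    have h5 : (D ^ 2) • (k * k) - D • k = cfc (fun t : ℝ ↦ D ^ 2 * (t * t) - D * t) k := by
      rw [cfc_sub (fun t : ℝ ↦ D ^ 2 * (t * t)) (fun t ↦ D * t) k,
        cfc_const_mul (D ^ 2) (fun t : ℝ ↦ t * t) k, cfc_const_mul D (fun t : ℝ ↦ t) k,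
        cfc_mul (fun t : ℝ ↦ t) (fun t ↦ t) k, cfc_id' ℝ k]
    rw [h5, cfc_nonneg_iff _ k] at h2
    intro t ht
    rcases (hspec0 t ht).eq_or_lt with h | h
    · exact .inl h.symm
    · right
      have h6 := h2 t ht
      rw [inv_le_iff_one_le_mul₀ hDpos]
      have h7 : 0 ≤ (D * t) * (D * t - 1) := by linarith
      have := nonneg_of_mul_nonneg_right h7 (by positivity)
      linarith
  set f : ℝ → ℝ := fun t ↦ (Real.sqrt (max t D⁻¹))⁻¹ with hf
  have hmax : ∀ t : ℝ, 0 < max t D⁻¹ := fun t ↦ lt_max_of_lt_right (by positivity)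
  have hfc : Continuous f :=
    (Real.continuous_sqrt.comp (continuous_id.max continuous_const)).inv₀
      fun t ↦ (Real.sqrt_pos.2 (hmax t)).ne'
  have hfcon : ContinuousOn f (spectrum ℝ k) := hfc.continuousOn
  have hsc : ContinuousOn Real.sqrt (spectrum ℝ k) := Real.continuous_sqrt.continuousOn
  have hfsq : ∀ t ∈ spectrum ℝ k, t * (f t * f t) * t = t := by
    intro t ht
    have h0 : f t * f t = (max t D⁻¹)⁻¹ := by
      rw [hf, ← mul_inv, Real.mul_self_sqrt (hmax t).le]
    rw [h0]
    rcases hgap t ht with h | h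
    · simp [h]
    · have : t ≠ 0 := (lt_of_lt_of_le (by positivity) h).ne'
      rw [max_eq_left h]; field_simp
  have hfs : ∀ t ∈ spectrum ℝ k, f t * Real.sqrt t * t = t := by
    intro t ht
    rcases hgap t ht with h | h
    · simp [h]
    · have : 0 < t := lt_of_lt_of_le (by positivity) h
      simp only [hf]
      rw [max_eq_left h, inv_mul_cancel₀ (Real.sqrt_pos.2 this).ne', one_mul]
  have hFsa : IsSelfAdjoint (cfc f k) := cfc_predicate f k
  have hFk : Commute (cfc f k) k := by
    simpa [cfc_id' ℝ k] using cfc_commute_cfc f (fun t : ℝ ↦ t) k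
  have hHsa : IsSelfAdjoint (cfc Real.sqrt k) := cfc_predicate _ k
  have hkFFk : k * (cfc f k * cfc f k) * k = k := by
    conv_rhs => rw [← cfc_id' ℝ k, ← cfc_congr hfsq]
    rw [cfc_mul (fun t ↦ t * (f t * f t)) (fun t ↦ t) k, cfc_mul (fun t ↦ t) (fun t ↦ f t * f t) k,
      cfc_mul f f k, cfc_id' ℝ k]
  have hFHk : cfc f k * cfc Real.sqrt k * k = k := by
    conv_rhs => rw [← cfc_id' ℝ k, ← cfc_congr hfs]
    rw [cfc_mul (fun t ↦ f t * Real.sqrt t) (fun t ↦ t) k, cfc_mul f Real.sqrt k, cfc_id' ℝ k]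
  have hHH : cfc Real.sqrt k * cfc Real.sqrt k = k := by
    conv_rhs => rw [← cfc_id' ℝ k]
    rw [← cfc_mul Real.sqrt Real.sqrt k]
    exact cfc_congr fun t ht ↦ Real.mul_self_sqrt (hspec0 t ht)
  have hcancel : ∀ z : A, k * z = 0 → b * z = 0 := by
    intro z hz
    rw [← CStarRing.star_mul_self_eq_zero_iff, star_mul, mul_assoc, ← mul_assoc (star b), ← hk, hz,
      mul_zero]
  set F := cfc f k
  set H := cfc Real.sqrt k
  have hbFFk : b * (F * F) * k = b := by
    have := hcancel ((F * F) * k - 1) (by rw [mul_sub, ← mul_assoc, hkFFk, mul_one, sub_self])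
    rwa [mul_sub, mul_one, sub_eq_zero, ← mul_assoc] at this
  have hsv : star (b * F) * (b * F) = F * F * k := by
    rw [star_mul, hFsa.star_eq, mul_assoc, ← mul_assoc (star b), ← hk, ← hFk.eq, mul_assoc]
  have hFH : Commute F H := cfc_commute_cfc f Real.sqrt k
  have hHk : Commute H k := by
    simpa [cfc_id' ℝ k] using cfc_commute_cfc Real.sqrt (fun t : ℝ ↦ t) k
  refine ⟨b * F, H, hHsa, ?_, hHH, ?_, ?_, ?_, ?_⟩
  · have hH0 : 0 ≤ H := cfc_nonneg fun t _ ↦ Real.sqrt_nonneg t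
    exact CStarAlgebra.isUnit_of_le 1 (le_add_of_nonneg_left hH0)
  · have := hcancel (F * H - 1) (by
      rw [mul_sub, mul_one, ← ((hFk.mul_left hHk)).eq, hFHk, sub_self])
    rwa [mul_sub, mul_one, sub_eq_zero, ← mul_assoc] at this
  · rw [mul_assoc, hsv]
    calc b * F * (F * F * k) = b * (F * F) * (F * k) := by simp only [mul_assoc]
      _ = b * (F * F) * k * F := by rw [hFk.eq]; simp only [mul_assoc]
      _ = _ := by rw [hbFFk]
  · rw [hsv, mul_sub, mul_one, ← mul_assoc, hbFFk, sub_self]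
  · rw [sub_mul, one_mul, sub_eq_zero, star_mul, hFsa.star_eq]
    conv_lhs => rw [← hbFFk]
    rw [hk]
    simp only [mul_assoc]

end PolarDecomposition

section Multipliers

variable {I A : Type*} [NonUnitalCStarAlgebra I] [CStarAlgebra A]

open DoubleCentralizer in
/-- A C*-algebra containing `I` as a closed ideal maps canonically to the multiplier algebra
of `I`. -/
lemma DoubleCentralizer.exists_starAlgHom_of_ideal (ι : I →⋆ₙₐ[ℂ] A) (hι : Isometry ι)
    (hideal : ∀ (a : A) (x : I), a * ι x ∈ Set.range ι ∧ ι x * a ∈ Set.range ι) :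
    ∃ σ : A →⋆ₐ[ℂ] 𝓜(ℂ, I), ∀ x : I, σ (ι x) = (x : 𝓜(ℂ, I)) := by
  choose L hL using fun a x ↦ (hideal a x).1
  choose R hR using fun a x ↦ (hideal a x).2
  have hinj := hι.injective
  have hnorm : ∀ x, ‖ι x‖ = ‖x‖ := fun x ↦ by
    simpa using hι.dist_eq x 0
  let Lc (a : A) : I →L[ℂ] I := LinearMap.mkContinuous
    { toFun := L a
      map_add' := fun x y ↦ hinj (by simp [hL, mul_add])
      map_smul' := fun r x ↦ hinj (by simp [hL]) } ‖a‖
    fun x ↦ by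
      rw [← hnorm, ← hnorm x]
      exact (congrArg norm (hL a x)).trans_le (norm_mul_le _ _)
  let Rc (a : A) : I →L[ℂ] I := LinearMap.mkContinuous
    { toFun := R a
      map_add' := fun x y ↦ hinj (by simp [hR, add_mul])
      map_smul' := fun r x ↦ hinj (by simp [hR]) } ‖a‖
    fun x ↦ by
      rw [← hnorm, ← hnorm x, mul_comm]
      exact (congrArg norm (hR a x)).trans_le (norm_mul_le _ _)
  have hLc : ∀ a x, ι (Lc a x) = a * ι x := hL
  have hRc : ∀ a x, ι (Rc a x) = ι x * a := hR
  let m (a : A) : 𝓜(ℂ, I) :=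
    { fst := Lc a
      snd := Rc a
      central := fun x y ↦ hinj (by simp only [map_mul, hLc, hRc, mul_assoc]) }
  have hm1 : ∀ a x, ι ((m a).fst x) = a * ι x := hL
  have hm2 : ∀ a x, ι ((m a).snd x) = ι x * a := hR
  have hext : ∀ {p r : 𝓜(ℂ, I)}, (∀ x, ι (p.fst x) = ι (r.fst x)) →
      (∀ x, ι (p.snd x) = ι (r.snd x)) → p = r := fun h1 h2 ↦
    DoubleCentralizer.ext _ _ _ _ (Prod.ext (ContinuousLinearMap.ext fun x ↦ hinj (h1 x))
      (ContinuousLinearMap.ext fun x ↦ hinj (h2 x)))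
  refine ⟨
    { toFun := m
      map_one' := hext (fun x ↦ by simp [hm1]) (fun x ↦ by simp [hm2])
      map_mul' := fun a b ↦ hext (fun x ↦ by simp [hm1, mul_assoc])
        (fun x ↦ by simp [hm2, mul_assoc])
      map_zero' := hext (fun x ↦ by simp [hm1]) (fun x ↦ by simp [hm2])
      map_add' := fun a b ↦ hext (fun x ↦ by simp [hm1, add_mul])
        (fun x ↦ by simp [hm2, mul_add])
      commutes' := fun r ↦ hext (fun x ↦ by simp [hm1, Algebra.algebraMap_eq_smul_one])
        (fun x ↦ by simp [hm2, Algebra.algebraMap_eq_smul_one])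
      map_star' := fun a ↦ hext (fun x ↦ by simp [hm1, hm2, map_star])
        (fun x ↦ by simp [hm1, hm2, map_star]) },
    fun x ↦ hext (fun y ↦ ?_) (fun y ↦ ?_)⟩
  · exact (hm1 _ _).trans (by simp)
  · exact (hm2 _ _).trans (by simp)

lemma DoubleCentralizer.mul_coe (m : 𝓜(ℂ, I)) (x : I) :
    m * (x : 𝓜(ℂ, I)) = (m.fst x : I) := by
  have hfst : ∀ y, m.fst (x * y) = m.fst x * y := fun y ↦ by
    have h : ∀ z, z * (m.fst (x * y) - m.fst x * y) = 0 := fun z ↦ by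
      rw [mul_sub, ← m.central, ← mul_assoc, ← mul_assoc, ← m.central, sub_self]
    exact sub_eq_zero.1 (CStarRing.star_mul_self_eq_zero_iff _ |>.1 (h _))
  refine DoubleCentralizer.ext _ _ _ _ (Prod.ext ?_ ?_)
  · exact ContinuousLinearMap.ext hfst
  · exact ContinuousLinearMap.ext fun y ↦ m.central y x

lemma DoubleCentralizer.star_coe (x : I) : star (x : 𝓜(ℂ, I)) = (star x : I) :=
  (map_star (DoubleCentralizer.coeHom (𝕜 := ℂ) (A := I)) x).symm

lemma DoubleCentralizer.coe_mul_mem_range (x : I) (m : 𝓜(ℂ, I)) :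
    ∃ y : I, (x : 𝓜(ℂ, I)) * m = (y : 𝓜(ℂ, I)) := by
  refine ⟨star ((star m).fst (star x)), ?_⟩
  rw [← DoubleCentralizer.star_coe, ← DoubleCentralizer.mul_coe, star_mul, star_star,
    DoubleCentralizer.star_coe, star_star]

lemma DoubleCentralizer.coe_injective :
    Function.Injective (fun x : I ↦ (x : 𝓜(ℂ, I))) := by
  refine (injective_iff_map_eq_zero (DoubleCentralizer.coeHom (𝕜 := ℂ) (A := I))).2 fun x hx ↦ ?_
  have h : (DoubleCentralizer.coeHom (𝕜 := ℂ) (A := I) x).fst (star x) = 0 := by rw [hx]; rfl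
  exact CStarRing.mul_star_self_eq_zero_iff _ |>.1 h

variable (I) in
/-- The canonical image of `I` as an ideal of its multiplier algebra. -/
noncomputable def DoubleCentralizer.coeIdeal : Ideal 𝓜(ℂ, I) where
  carrier := Set.range (fun x : I ↦ (x : 𝓜(ℂ, I)))
  add_mem' := by
    rintro _ _ ⟨x, rfl⟩ ⟨y, rfl⟩
    exact ⟨x + y, map_add (DoubleCentralizer.coeHom (𝕜 := ℂ) (A := I)) x y⟩
  zero_mem' := ⟨0, map_zero (DoubleCentralizer.coeHom (𝕜 := ℂ) (A := I))⟩
  smul_mem' := by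
    rintro m _ ⟨x, rfl⟩
    exact ⟨m.fst x, (DoubleCentralizer.mul_coe m x).symm⟩

instance DoubleCentralizer.isTwoSided_coeIdeal :
    (DoubleCentralizer.coeIdeal I).IsTwoSided where
  mul_mem_of_left := by
    rintro _ m ⟨x, rfl⟩
    obtain ⟨y, hy⟩ := DoubleCentralizer.coe_mul_mem_range x m
    exact ⟨y, hy.symm⟩

end Multipliers

section Lifting

/-- In an extremally rich C*-algebra, an element that is an isometry modulo a star-closed two-sided
ideal is congruent to an extreme point of the closed unit ball. -/
lemma ExtremallyRich.exists_mem_extremePoints_sub_mem {M : Type*} [CStarAlgebra M]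
    (hM : ExtremallyRich M) (J : Ideal M) [J.IsTwoSided] (hJ : ∀ x ∈ J, star x ∈ J) {a : M}
    (ha : star a * a - 1 ∈ J) :
    ∃ v ∈ Set.extremePoints ℝ (Metric.closedBall (0 : M) 1), v - a ∈ J := by
  obtain ⟨b, hba, x, e, y, hx, hy, he, rfl⟩ := Metric.dense_iff.1 hM a (‖a‖ + 1)⁻¹ (by positivity)
  rw [Metric.mem_ball, dist_eq_norm, ← norm_neg, neg_sub] at hba
  have hg : IsUnit (1 - (a - x * e * y) * star a) := by
    refine isUnit_one_sub_of_norm_lt_one ((norm_mul_le _ _).trans_lt ?_)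
    rw [norm_star]
    calc _ ≤ (‖a‖ + 1)⁻¹ * ‖a‖ := by gcongr
      _ < 1 := by
        rw [inv_mul_lt_iff₀ (by positivity)]; linarith
  obtain ⟨g, hg⟩ := hg
  obtain ⟨x, rfl⟩ := hx
  obtain ⟨y, rfl⟩ := hy
  have hpi := mul_star_mul_self_of_mem_extremePoints_closedBall he
  set b : M := ↑g⁻¹ * (x * e * y) with hb
  -- `b` is congruent to `a`
  let π := Ideal.Quotient.mk J
  have hπ : π (star a) * π a = 1 := by
    rw [← map_mul, ← map_one π]; exact Ideal.Quotient.eq.2 ha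
  have hπg : π g * π a = π (x * e * y) := by
    rw [hg, map_sub, map_one, map_mul, map_sub, sub_mul, one_mul, mul_assoc, hπ,
      mul_one, sub_sub_cancel]
  have hπb : π b = π a := by
    rw [hb, map_mul, ← hπg, ← mul_assoc, ← map_mul, Units.inv_mul, map_one, one_mul]
  have hπb' : π (star b) = π (star a) := by
    refine Ideal.Quotient.eq.2 ?_
    rw [← star_sub]
    exact hJ _ (Ideal.Quotient.eq.1 hπb)
  have hbc : b * (↑y⁻¹ * star e * ↑x⁻¹ * g) * b = b := by
    calc _ = ↑g⁻¹ * x * e * (y * ↑y⁻¹) * star e * (↑x⁻¹ * ((g * ↑g⁻¹) * x)) * e * y := by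
          simp only [hb, mul_assoc]
      _ = ↑g⁻¹ * x * (e * star e * e) * y := by simp [mul_assoc]
      _ = _ := by rw [hpi, hb]; simp only [mul_assoc]
  obtain ⟨v, h, -, hh1, hhh, hvh, hv, hbv, hvb⟩ := exists_polarDecomposition_of_mul_mul_eq_self hbc
  have hπh : π h = 1 := by
    have h1 : π (h - 1) * π (h + 1) = 0 := by
      have : (h - 1) * (h + 1) = star b * b - 1 := by rw [← hhh]; noncomm_ring
      rw [← map_mul, this, map_sub, map_mul, hπb, hπb', hπ, map_one, sub_self]
    have h2 := (hh1.map π).mul_left_eq_zero.1 h1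
    rwa [map_sub, map_one, sub_eq_zero] at h2
  refine ⟨v, mem_extremePoints_closedBall_of_one_sub_mul_mul_one_sub hv fun z ↦ ?_, ?_⟩
  · have hey : e * (y * (1 - star v * v)) = 0 := by
      have : (↑x⁻¹ * g : M) * (b * (1 - star v * v)) = e * (y * (1 - star v * v)) := by
        simp [hb, mul_assoc]
      rw [← this, hbv, mul_zero]
    have hxe : (1 - v * star v) * ↑g⁻¹ * x * e = 0 := by
      have : ((1 - v * star v) * b) * ↑y⁻¹ = (1 - v * star v) * ↑g⁻¹ * x * e := by
        simp [hb, mul_assoc]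
      rw [← this, hvb, zero_mul]
    have h1 : (1 - star e * e) * (y * (1 - star v * v)) = y * (1 - star v * v) := by
      rw [sub_mul, one_mul, mul_assoc (star e), hey, mul_zero, sub_zero]
    have h2 : (1 - v * star v) * ↑g⁻¹ * x * (1 - e * star e) = (1 - v * star v) * ↑g⁻¹ * x := by
      rw [mul_sub, mul_one, ← mul_assoc, hxe, zero_mul, sub_zero]
    calc (1 - v * star v) * z * (1 - star v * v)
        = ((1 - v * star v) * ↑g⁻¹ * x) * (↑x⁻¹ * g * z * ↑y⁻¹) * (y * (1 - star v * v)) := by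
          simp [mul_assoc]
      _ = ((1 - v * star v) * ↑g⁻¹ * x) * ((1 - e * star e) * (↑x⁻¹ * g * z * ↑y⁻¹) *
            (1 - star e * e)) * (y * (1 - star v * v)) := by
          nth_rewrite 1 [← h1, ← h2]; simp only [mul_assoc]
      _ = 0 := by
          rw [one_sub_mul_mul_one_sub_of_mem_extremePoints_closedBall he, mul_zero, zero_mul]
  · rw [← Ideal.Quotient.eq]
    change π v = π a
    rw [← hπb, ← hvh, map_mul, hπh, mul_one]

end Lifting

/-- Let `I` be a C*-algebra whose multiplier algebra `𝓜(ℂ, I)` is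
extremally rich, and suppose a unital C*-algebra `A` contains `I` as a closed two-sided
ideal (via the isometric embedding `ι`), with `q : A → B` realizing the quotient `B = A/I`.
Then every unitary `u` in `A/I` lifts to an extremal partial isometry (extreme point of the
closed unit ball) in `A`. -/
theorem stmt5 {I A B : Type*} [NonUnitalCStarAlgebra I] [CStarAlgebra A] [CStarAlgebra B]
    (hM : ExtremallyRich 𝓜(ℂ, I))
    (ι : I →⋆ₙₐ[ℂ] A) (hιisom : Isometry ι)
    (hideal : ∀ (a : A) (x : I), a * ι x ∈ Set.range ι ∧ ι x * a ∈ Set.range ι)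
    (q : A →⋆ₐ[ℂ] B) (hqsurj : Function.Surjective q)
    (hker : ∀ a : A, q a = 0 ↔ a ∈ Set.range ι) :
    ∀ u ∈ unitary B,
      ∃ v ∈ Set.extremePoints ℝ (Metric.closedBall (0 : A) 1), q v = u := by
  intro u hu
  obtain ⟨σ, hσ⟩ := DoubleCentralizer.exists_starAlgHom_of_ideal ι hιisom hideal
  have hσq : ∀ a, q a = 0 → σ a ∈ DoubleCentralizer.coeIdeal I := fun a ha ↦ by
    obtain ⟨x, rfl⟩ := (hker a).1 ha
    exact ⟨x, (hσ x).symm⟩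
  have hzero : ∀ a, q a = 0 → σ a = 0 → a = 0 := fun a ha hσa ↦ by
    obtain ⟨x, rfl⟩ := (hker a).1 ha
    have hx : x = 0 := DoubleCentralizer.coe_injective
      ((hσ x).symm.trans (hσa.trans (map_zero (DoubleCentralizer.coeHom (𝕜 := ℂ))).symm))
    rw [hx, map_zero]
  obtain ⟨a, rfl⟩ := hqsurj u
  rw [Unitary.mem_iff] at hu
  obtain ⟨v, hv, x, hx⟩ := hM.exists_mem_extremePoints_sub_mem (DoubleCentralizer.coeIdeal I)
    (by
      rintro _ ⟨x, rfl⟩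
      exact ⟨star x, (DoubleCentralizer.star_coe x).symm⟩) (a := σ a)
    (by simpa [map_star] using hσq (star a * a - 1) (by simp [map_star, hu.1]))
  have hσv : σ (a + ι x) = v := by
    rw [map_add, hσ]
    exact (congrArg (σ a + ·) hx).trans (add_sub_cancel _ _)
  have hqv : q (a + ι x) = q a := by
    rw [map_add, (hker _).2 ⟨x, rfl⟩, add_zero]
  refine ⟨a + ι x, ?_, hqv⟩
  refine mem_extremePoints_closedBall_of_one_sub_mul_mul_one_sub
    (sub_eq_zero.1 (hzero _ ?_ ?_)) fun z ↦ hzero _ ?_ ?_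
  · simp only [map_sub, map_mul, map_star, hqv, hu.2, one_mul, sub_self]
  · simp only [map_sub, map_mul, map_star, hσv,
      mul_star_mul_self_of_mem_extremePoints_closedBall hv, sub_self]
  · simp only [map_sub, map_mul, map_star, map_one, hqv, hu.1, sub_self, mul_zero]
  · simp only [map_sub, map_mul, map_star, map_one, hσv]
    exact one_sub_mul_mul_one_sub_of_mem_extremePoints_closedBall hv _
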